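/- arXiv:1603.04729 — 4 statements merged into one kernel-verified Lean document; each statement's English description precedes it below -/
import Mathlib

section
/- Let ξ ∈ Sym_d and let V ∈ L^p(Y; Sym_d) satisfy ∫_Y V(y) dy = 0 and the orthogonality relation ∫_Y S(y, ξ + V(y)) : V(y) dy = 0. Then the homogenized stress Ŝ(ξ) := ∫_Y S(y, ξ + V(y)) dy satisfies the coercivity bound Ŝ(ξ) : ξ ≥ c₁ |ξ|^p − c̃₁. -/
open MeasureTheory Filter Set Matrix

noncomputable section

/-- The unit cell `Y = (0,1]^d`. -/
def Ycell (d : ℕ) : Set (EuclideanSpace ℝ (Fin d)) :=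
  {y | ∀ i, y i ∈ Set.Ioc (0 : ℝ) 1}

/-- Frobenius inner product `A : B = Σ_{ij} a_{ij} b_{ij}` on `d×d` matrices. -/
def mdot {d : ℕ} (A B : Matrix (Fin d) (Fin d) ℝ) : ℝ :=
  ∑ i, ∑ j, A i j * B i j

/-- The Frobenius norm `|A| = √(A : A)`. -/
def mnorm {d : ℕ} (A : Matrix (Fin d) (Fin d) ℝ) : ℝ :=
  Real.sqrt (mdot A A)

lemma aux_int {d : ℕ} {X : Type*} [MeasurableSpace X] {μ : Measure X} (f : Fin d → Fin d → X → ℝ)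
    (hf : ∀ i j, Integrable (f i j) μ) :
    ∫ y, ∑ i, ∑ j, f i j y ∂μ = ∑ i, ∑ j, ∫ y, f i j y ∂μ := by
  rw [integral_finsetSum _ fun i _ => integrable_finsetSum _ fun j _ => hf i j]
  refine Finset.sum_congr rfl fun i _ => ?_
  rw [integral_finsetSum _ fun j _ => hf i j]

lemma aux_mdot_self_nonneg {d : ℕ} (A : Matrix (Fin d) (Fin d) ℝ) : 0 ≤ mdot A A :=
  Finset.sum_nonneg fun i _ => Finset.sum_nonneg fun j _ => mul_self_nonneg _

lemma aux_mnorm_nonneg {d : ℕ} (A : Matrix (Fin d) (Fin d) ℝ) : 0 ≤ mnorm A := Real.sqrt_nonneg _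

lemma aux_mnorm_sq {d : ℕ} (A : Matrix (Fin d) (Fin d) ℝ) : mnorm A * mnorm A = mdot A A :=
  Real.mul_self_sqrt (aux_mdot_self_nonneg A)

lemma aux_entry_le {d : ℕ} (A : Matrix (Fin d) (Fin d) ℝ) (i j : Fin d) : |A i j| ≤ mnorm A := by
  apply Real.abs_le_sqrt
  have h1 : A i j * A i j ≤ ∑ j, A i j * A i j :=
    Finset.single_le_sum (f := fun j => A i j * A i j) (fun j _ => mul_self_nonneg _)
      (Finset.mem_univ j)
  have h2 : ∑ j, A i j * A i j ≤ mdot A A :=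
    Finset.single_le_sum (f := fun i => ∑ j, A i j * A i j)
      (fun i _ => Finset.sum_nonneg fun j _ => mul_self_nonneg _) (Finset.mem_univ i)
  nlinarith

lemma aux_cs {d : ℕ} (A B : Matrix (Fin d) (Fin d) ℝ) : mdot A B ≤ mnorm A * mnorm B := by
  have h := Real.sum_mul_le_sqrt_mul_sqrt (Finset.univ : Finset (Fin d × Fin d))
    (fun x => A x.1 x.2) (fun x => B x.1 x.2)
  simp only [← Finset.univ_product_univ, Finset.sum_product, pow_two] at h
  exact h

lemma aux_add {d : ℕ} (p : ℝ) (hp : 1 < p) (A B : Matrix (Fin d) (Fin d) ℝ) :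
    mnorm (A + B) ^ p ≤ 2 ^ p * (mnorm A ^ p + mnorm B ^ p) := by
  have hA := aux_mnorm_nonneg A
  have hB := aux_mnorm_nonneg B
  have hle : mnorm (A + B) ≤ mnorm A + mnorm B := by
    apply Real.sqrt_le_iff.2 ⟨by positivity, ?_⟩
    have e : mdot (A + B) (A + B) = mdot A A + 2 * mdot A B + mdot B B := by
      simp only [mdot, Finset.mul_sum, ← Finset.sum_add_distrib, Matrix.add_apply]
      refine Finset.sum_congr rfl fun i _ => Finset.sum_congr rfl fun j _ => ?_
      ring
    have := aux_cs A B
    have := aux_mnorm_sq A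
    have := aux_mnorm_sq B
    rw [e]; nlinarith
  have hp0 : 0 ≤ p := by linarith
  rcases le_total (mnorm A) (mnorm B) with h | h
  · calc mnorm (A + B) ^ p ≤ (2 * mnorm B) ^ p :=
          Real.rpow_le_rpow (aux_mnorm_nonneg _) (by linarith) hp0
      _ = 2 ^ p * mnorm B ^ p := Real.mul_rpow (by norm_num) hB
      _ ≤ _ := by
        have : 0 ≤ mnorm A ^ p := by positivity
        gcongr; linarith
  · calc mnorm (A + B) ^ p ≤ (2 * mnorm A) ^ p :=
          Real.rpow_le_rpow (aux_mnorm_nonneg _) (by linarith) hp0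
      _ = 2 ^ p * mnorm A ^ p := Real.mul_rpow (by norm_num) hA
      _ ≤ _ := by
        have : 0 ≤ mnorm B ^ p := by positivity
        gcongr; linarith

lemma aux_le_one_add {t p : ℝ} (ht : 0 ≤ t) (hp : 1 < p) : t ≤ 1 + t ^ p := by
  rcases le_total t 1 with h | h
  · have : 0 ≤ t ^ p := by positivity
    linarith
  · have := Real.rpow_le_rpow_of_exponent_le h hp.le
    rw [Real.rpow_one] at this
    linarith

lemma aux_tangent {a t p : ℝ} (ha : 0 < a) (ht : 0 ≤ t) (hp : 1 < p) :
    a ^ p + p * a ^ p / a * (t - a) ≤ t ^ p := by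
  have h := one_add_mul_self_le_rpow_one_add (s := t / a - 1) (p := p)
    (by have : 0 ≤ t / a := by positivity
        linarith) hp.le
  have e : 1 + (t / a - 1) = t / a := by ring
  rw [e, Real.div_rpow ht ha.le, le_div_iff₀ (by positivity)] at h
  refine le_trans (le_of_eq ?_) h
  field_simp

lemma aux_meas (d : ℕ) : MeasurableSet (Ycell d) := by
  have : Ycell d = ⋂ i, (fun y : EuclideanSpace ℝ (Fin d) => y i) ⁻¹' Set.Ioc (0:ℝ) 1 := by
    ext y; simp [Ycell]
  rw [this]
  refine MeasurableSet.iInter fun i => ?_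
  exact measurableSet_Ioc.preimage (by fun_prop)

lemma aux_vol (d : ℕ) : volume (Ycell d) = 1 := by
  have h := (EuclideanSpace.volume_preserving_symm_measurableEquiv_toLp (Fin d)).measure_preimage
    (s := Set.pi Set.univ fun _ => Set.Ioc (0:ℝ) 1)
    (MeasurableSet.univ_pi fun _ => measurableSet_Ioc).nullMeasurableSet
  rw [Real.volume_pi_Ioc] at h
  simp only [sub_zero, ENNReal.ofReal_one, Finset.prod_const_one] at h
  rw [← h]
  congr 1
  ext y
  simp [Ycell, Set.mem_pi]

lemma aux_carath {d : ℕ} (S : EuclideanSpace ℝ (Fin d) → Matrix (Fin d) (Fin d) ℝ → ℝ)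
    (h1 : ∀ ξ, Measurable fun y => S y ξ) (h2 : ∀ᵐ y, Continuous fun ξ => S y ξ)
    (W : EuclideanSpace ℝ (Fin d) → Matrix (Fin d) (Fin d) ℝ)
    (hW : ∀ i j : Fin d, Measurable fun y => W y i j) :
    AEMeasurable (fun y => S y (W y)) volume := by
  obtain ⟨N, hN, hNm, hN0⟩ := exists_measurable_superset_of_null (ae_iff.1 h2)
  classical
  let u : (Fin d → Fin d → ℝ) → EuclideanSpace ℝ (Fin d) → ℝ :=
    fun ξ y => if y ∈ N then 0 else S y ξ
  have hu : Measurable (Function.uncurry u) := by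
    apply measurable_uncurry_of_continuous_of_measurable
    · intro y
      by_cases hy : y ∈ N
      · simp only [u, hy, if_true]; exact continuous_const
      · simp only [u, hy, if_false]
        by_contra hc
        exact hy (hN hc)
    · intro ξ
      exact Measurable.ite hNm measurable_const (h1 ξ)
  have hWm : Measurable (fun y => (fun i j => W y i j : Fin d → Fin d → ℝ)) :=
    measurable_pi_lambda _ fun i => measurable_pi_lambda _ fun j => hW i j
  refine ⟨fun y => u (fun i j => W y i j) y, hu.comp (hWm.prodMk measurable_id), ?_⟩
  have : ∀ᵐ y ∂(volume : Measure (EuclideanSpace ℝ (Fin d))), y ∉ N := measure_eq_zero_iff_ae_notMem.1 hN0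
  filter_upwards [this] with y hy
  simp only [u, hy, if_false]

/-- coercivity of the homogenized stress: if `ξ ∈ Sym_d`,
`V ∈ L^p(Y; Sym_d)` has zero mean and satisfies `∫_Y S(y, ξ + V(y)) : V(y) dy = 0`,
then `Ŝ(ξ) := ∫_Y S(y, ξ + V(y)) dy` satisfies `Ŝ(ξ) : ξ ≥ c₁ |ξ|^p − c̃₁`. -/
theorem stmt7 {d : ℕ} (hd : 1 ≤ d) (p p' c₁ ct₁ c₂ : ℝ)
    (hp : 1 < p) (hp' : p' = p / (p - 1))
    (hc₁ : 0 < c₁) (hct₁ : 0 < ct₁) (hc₂ : 0 < c₂)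
    (S : EuclideanSpace ℝ (Fin d) → Matrix (Fin d) (Fin d) ℝ → Matrix (Fin d) (Fin d) ℝ)
    -- (S2) Carathéodory
    (hS2a : ∀ (ξ : Matrix (Fin d) (Fin d) ℝ) (i j : Fin d),
      Measurable fun y => S y ξ i j)
    (hS2b : ∀ᵐ y : EuclideanSpace ℝ (Fin d), ∀ i j : Fin d,
      Continuous fun ξ => S y ξ i j)
    -- (S3) strict monotonicity
    (hS3 : ∀ᵐ y : EuclideanSpace ℝ (Fin d), ∀ ξ₁ ξ₂ : Matrix (Fin d) (Fin d) ℝ,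
      ξ₁ ≠ ξ₂ → 0 < mdot (S y ξ₁ - S y ξ₂) (ξ₁ - ξ₂))
    -- (S4) coercivity and growth
    (hS4a : ∀ (y : EuclideanSpace ℝ (Fin d)) (ξ : Matrix (Fin d) (Fin d) ℝ),
      c₁ * mnorm ξ ^ p - ct₁ ≤ mdot (S y ξ) ξ)
    (hS4b : ∀ (y : EuclideanSpace ℝ (Fin d)) (ξ : Matrix (Fin d) (Fin d) ℝ),
      mnorm (S y ξ) ^ p' ≤ c₂ * (mnorm ξ ^ p + 1))
    -- the data of the cell problem
    (ξ : Matrix (Fin d) (Fin d) ℝ) (hξ : ξᵀ = ξ)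
    (V : EuclideanSpace ℝ (Fin d) → Matrix (Fin d) (Fin d) ℝ)
    (hVmeas : ∀ i j : Fin d, Measurable fun y => V y i j)
    (hVsym : ∀ᵐ y ∂(volume.restrict (Ycell d)), (V y)ᵀ = V y)
    (hVLp : IntegrableOn (fun y => mnorm (V y) ^ p) (Ycell d))
    (hVmean : ∀ i j : Fin d, ∫ y in Ycell d, V y i j = 0)
    (hOrth : ∫ y in Ycell d, mdot (S y (ξ + V y)) (V y) = 0) :
    c₁ * mnorm ξ ^ p - ct₁ ≤
      mdot (Matrix.of fun i j => ∫ y in Ycell d, S y (ξ + V y) i j) ξ := by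
  have hp0 : 0 < p := by linarith
  have hconj : p.HolderConjugate p' := by
    rw [hp']; exact Real.HolderConjugate.conjExponent hp
  have hp'1 : 1 < p' := hconj.symm.lt
  haveI : IsProbabilityMeasure (volume.restrict (Ycell d)) :=
    ⟨by rw [Measure.restrict_apply_univ, aux_vol]⟩
  set μ := volume.restrict (Ycell d) with hμ
  replace hVLp : Integrable (fun y => mnorm (V y) ^ p) μ := hVLp
  have hWmeas : ∀ i j, Measurable fun y => (ξ + V y) i j := fun i j => by
    simp only [Matrix.add_apply]; exact (hVmeas i j).const_add _
  have hSm : ∀ i j, AEStronglyMeasurable (fun y => S y (ξ + V y) i j) μ := fun i j =>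
    (aux_carath (fun y ξ => S y ξ i j) (fun ξ => hS2a ξ i j)
      (hS2b.mono fun y hy => hy i j) _ hWmeas).restrict.aestronglyMeasurable
  have hnm : ∀ U : EuclideanSpace ℝ (Fin d) → Matrix (Fin d) (Fin d) ℝ,
      (∀ i j, Measurable fun y => U y i j) → Measurable fun y => mnorm (U y) ^ p := by
    intro U hU
    unfold mnorm mdot
    fun_prop
  have hWp : Integrable (fun y => mnorm (ξ + V y) ^ p) μ := by
    refine Integrable.mono' (((integrable_const (mnorm ξ ^ p)).add hVLp).const_mul (2 ^ p))
      (hnm _ hWmeas).aestronglyMeasurable (Eventually.of_forall fun y => ?_)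
    rw [Real.norm_of_nonneg (Real.rpow_nonneg (aux_mnorm_nonneg _) _)]
    exact aux_add p hp _ _
  have hbd : Integrable (fun y => c₂ * (mnorm (ξ + V y) ^ p + 1)) μ :=
    (hWp.add (integrable_const 1)).const_mul c₂
  have hSi : ∀ i j, Integrable (fun y => S y (ξ + V y) i j) μ := fun i j => by
    refine Integrable.mono' ((integrable_const (1:ℝ)).add hbd) (hSm i j)
      (Eventually.of_forall fun y => ?_)
    rw [Real.norm_eq_abs]
    refine (aux_entry_le _ i j).trans ((aux_le_one_add (aux_mnorm_nonneg _) hp'1).trans ?_)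
    exact add_le_add le_rfl (hS4b _ _)
  have hVi : ∀ i j, Integrable (fun y => V y i j) μ := fun i j => by
    refine Integrable.mono' ((integrable_const (1:ℝ)).add hVLp)
      (hVmeas i j).aestronglyMeasurable (Eventually.of_forall fun y => ?_)
    rw [Real.norm_eq_abs]
    exact (aux_entry_le _ i j).trans (aux_le_one_add (aux_mnorm_nonneg _) hp)
  have hSVi : ∀ i j, Integrable (fun y => S y (ξ + V y) i j * V y i j) μ := fun i j => by
    refine Integrable.mono' ((hVLp.div_const p).add (hbd.div_const p'))
      ((hSm i j).mul (hVmeas i j).aestronglyMeasurable) (Eventually.of_forall fun y => ?_)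
    rw [Real.norm_eq_abs, abs_mul, mul_comm]
    have h0 := aux_mnorm_nonneg (V y)
    refine (mul_le_mul (aux_entry_le _ i j) (aux_entry_le _ i j) (abs_nonneg _) h0).trans ?_
    refine (Real.young_inequality_of_nonneg h0 (aux_mnorm_nonneg _) hconj).trans ?_
    refine add_le_add le_rfl (div_le_div_of_nonneg_right (hS4b _ _) (by linarith))
  have hSV : Integrable (fun y => mdot (S y (ξ + V y)) (V y)) μ :=
    integrable_finsetSum _ fun i _ => integrable_finsetSum _ fun j _ => hSVi i j
  have hSx : Integrable (fun y => mdot (S y (ξ + V y)) ξ) μ :=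
    integrable_finsetSum _ fun i _ => integrable_finsetSum _ fun j _ => (hSi i j).mul_const _
  have hxV : Integrable (fun y => mdot ξ (V y)) μ :=
    integrable_finsetSum _ fun i _ => integrable_finsetSum _ fun j _ => (hVi i j).const_mul _
  have hxV0 : ∫ y, mdot ξ (V y) ∂μ = 0 := by
    refine (aux_int (fun i j y => ξ i j * V y i j) fun i j => (hVi i j).const_mul _).trans ?_
    refine Finset.sum_eq_zero fun i _ => Finset.sum_eq_zero fun j _ => ?_
    exact (integral_const_mul _ _).trans (by rw [hVmean, mul_zero])
  have hL : mdot (Matrix.of fun i j => ∫ y, S y (ξ + V y) i j ∂μ) ξ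
      = ∫ y, mdot (S y (ξ + V y)) ξ ∂μ := by
    refine Eq.trans ?_
      (aux_int (fun i j y => S y (ξ + V y) i j * ξ i j) fun i j => (hSi i j).mul_const _).symm
    refine Finset.sum_congr rfl fun i _ => Finset.sum_congr rfl fun j _ => ?_
    exact (integral_mul_const _ _).symm
  have madd : ∀ A B C : Matrix (Fin d) (Fin d) ℝ, mdot A (B + C) = mdot A B + mdot A C := by
    intro A B C
    simp only [mdot, Matrix.add_apply, mul_add, Finset.sum_add_distrib]
  have hjen : mnorm ξ ^ p ≤ ∫ y, mnorm (ξ + V y) ^ p ∂μ := by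
    rcases (aux_mnorm_nonneg ξ).eq_or_lt with h | h
    · rw [← h, Real.zero_rpow hp0.ne']
      exact integral_nonneg fun y => Real.rpow_nonneg (aux_mnorm_nonneg _) _
    · have key : ∀ y, mnorm ξ ^ p + p * mnorm ξ ^ p / mnorm ξ / mnorm ξ * mdot ξ (V y)
          ≤ mnorm (ξ + V y) ^ p := by
        intro y
        refine le_trans ?_ (aux_tangent h (aux_mnorm_nonneg (ξ + V y)) hp)
        have h1 := aux_cs ξ (ξ + V y)
        rw [madd, ← aux_mnorm_sq] at h1
        have h2 : mdot ξ (V y) / mnorm ξ ≤ mnorm (ξ + V y) - mnorm ξ := by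
          rw [div_le_iff₀ h]; nlinarith
        have h3 : 0 ≤ p * mnorm ξ ^ p / mnorm ξ := by positivity
        have h4 := mul_le_mul_of_nonneg_left h2 h3
        have h5 : p * mnorm ξ ^ p / mnorm ξ / mnorm ξ * mdot ξ (V y)
          = p * mnorm ξ ^ p / mnorm ξ * (mdot ξ (V y) / mnorm ξ) := by ring
        rw [h5]; linarith
      have := integral_mono ((integrable_const _).add (hxV.const_mul _)) hWp key
      rw [integral_add' (integrable_const _) (hxV.const_mul _), integral_const_mul, hxV0] at this
      simpa using this
  have hfin : ∫ y, (c₁ * mnorm (ξ + V y) ^ p - ct₁) ∂μ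
      ≤ ∫ y, (mdot (S y (ξ + V y)) ξ + mdot (S y (ξ + V y)) (V y)) ∂μ := by
    refine integral_mono ((hWp.const_mul _).sub (integrable_const _)) (hSx.add hSV) fun y => ?_
    have := hS4a y (ξ + V y)
    rwa [madd] at this
  rw [integral_add hSx hSV, hOrth, integral_sub (hWp.const_mul _) (integrable_const _),
    integral_const_mul] at hfin
  rw [hL]
  have := mul_le_mul_of_nonneg_left hjen hc₁.le
  simp at hfin
  linarith
end
end

section
/- The cell problem has at most one solution: let ξ ∈ Sym_d and let V₁, V₂ ∈ L^p(Y; Sym_d) satisfy ∫_Y V_i(y) dy = 0 for i = 1,2 and the orthogonality relations ∫_Y S(y, ξ + V_i(y)) : (V₁(y) − V₂(y)) dy = 0 for i = 1,2. Then V₁ = V₂ almost everywhere in Y. -/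
open MeasureTheory Filter Set Matrix

noncomputable section

def mvec {d : ℕ} (A : Matrix (Fin d) (Fin d) ℝ) : EuclideanSpace ℝ (Fin d × Fin d) :=
  WithLp.toLp 2 (fun q => A q.1 q.2)

lemma mvec_add {d : ℕ} (A B : Matrix (Fin d) (Fin d) ℝ) : mvec (A + B) = mvec A + mvec B := by
  ext q; simp [mvec]

lemma mvec_sub {d : ℕ} (A B : Matrix (Fin d) (Fin d) ℝ) : mvec (A - B) = mvec A - mvec B := by
  ext q; simp [mvec]

lemma mdot_eq {d : ℕ} (A B : Matrix (Fin d) (Fin d) ℝ) : mdot A B = inner ℝ (mvec A) (mvec B) := by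
  simp only [mdot, mvec, PiLp.inner_apply, Fintype.sum_prod_type]
  simp [mul_comm]

lemma mnorm_eq {d : ℕ} (A : Matrix (Fin d) (Fin d) ℝ) : mnorm A = ‖mvec A‖ := by
  rw [mnorm, mdot_eq, real_inner_self_eq_norm_sq, Real.sqrt_sq (norm_nonneg _)]

lemma rpow_add_bd {a b c p : ℝ} (hc0 : 0 ≤ c) (ha : 0 ≤ a) (hb : 0 ≤ b) (hp : 0 < p) (hc : c ≤ a + b) :
    c ^ p ≤ 2 ^ p * (a ^ p + b ^ p) := by
  have hA : 0 ≤ a ^ p := Real.rpow_nonneg ha p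
  have hB : 0 ≤ b ^ p := Real.rpow_nonneg hb p
  have h2 : (0:ℝ) ≤ 2 ^ p := by positivity
  rcases le_total a b with h | h
  · calc c ^ p ≤ (2 * b) ^ p := Real.rpow_le_rpow hc0 (by linarith) hp.le
      _ = 2 ^ p * b ^ p := Real.mul_rpow (by norm_num) hb
      _ ≤ _ := mul_le_mul_of_nonneg_left (by linarith) h2
  · calc c ^ p ≤ (2 * a) ^ p := Real.rpow_le_rpow hc0 (by linarith) hp.le
      _ = 2 ^ p * a ^ p := Real.mul_rpow (by norm_num) ha
      _ ≤ _ := mul_le_mul_of_nonneg_left (by linarith) h2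

lemma Ycell_lt_top (d : ℕ) : volume (Ycell d) < ⊤ := by
  have hK : IsCompact ((WithLp.toLp 2 : (Fin d → ℝ) → EuclideanSpace ℝ (Fin d)) '' Set.Icc 0 1) :=
    isCompact_Icc.image (PiLp.continuous_toLp 2 _)
  refine lt_of_le_of_lt (measure_mono ?_) hK.measure_lt_top
  intro y hy
  refine ⟨fun i => y i, ⟨fun i => (hy i).1.le, fun i => (hy i).2⟩, rfl⟩

lemma carath {d : ℕ} (u : EuclideanSpace ℝ (Fin d) → (Fin d → Fin d → ℝ) → ℝ)
    (hm : ∀ ξ, Measurable fun y => u y ξ)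
    (hc : ∀ᵐ y : EuclideanSpace ℝ (Fin d), Continuous (u y))
    (V : EuclideanSpace ℝ (Fin d) → (Fin d → Fin d → ℝ)) (hV : Measurable V) :
    AEMeasurable fun y => u y (V y) := by
  classical
  obtain ⟨T, hT, hTm, hTc⟩ := hc.exists_measurable_mem
  let w : (Fin d → Fin d → ℝ) → EuclideanSpace ℝ (Fin d) → ℝ := fun ξ => T.indicator (fun y => u y ξ)
  have hw : Measurable (Function.uncurry w) := by
    apply measurable_uncurry_of_continuous_of_measurable
    · intro y
      by_cases hy : y ∈ T
      · simpa [w, hy] using hTc y hy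
      · simpa [w, hy] using continuous_const
    · intro ξ
      exact (hm ξ).indicator hTm
  refine ⟨fun y => w (V y) y, hw.comp (hV.prodMk measurable_id), ?_⟩
  filter_upwards [hT] with y hy
  simp [w, hy]

lemma mdot_integrable {d : ℕ} (p p' c₂ : ℝ)
    (hp : 1 < p) (hp' : p' = p / (p - 1)) (hc₂ : 0 < c₂)
    (S : EuclideanSpace ℝ (Fin d) → Matrix (Fin d) (Fin d) ℝ → Matrix (Fin d) (Fin d) ℝ)
    (hS2a : ∀ (ξ : Matrix (Fin d) (Fin d) ℝ) (i j : Fin d),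
      Measurable fun y => S y ξ i j)
    (hS2b : ∀ᵐ y : EuclideanSpace ℝ (Fin d), ∀ i j : Fin d,
      Continuous fun ξ => S y ξ i j)
    (hS4b : ∀ (y : EuclideanSpace ℝ (Fin d)) (ξ : Matrix (Fin d) (Fin d) ℝ),
      mnorm (S y ξ) ^ p' ≤ c₂ * (mnorm ξ ^ p + 1))
    (ξ : Matrix (Fin d) (Fin d) ℝ)
    (V V₁ V₂ : EuclideanSpace ℝ (Fin d) → Matrix (Fin d) (Fin d) ℝ)
    (hVmeas : ∀ i j : Fin d, Measurable fun y => V y i j)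
    (hV₁meas : ∀ i j : Fin d, Measurable fun y => V₁ y i j)
    (hV₂meas : ∀ i j : Fin d, Measurable fun y => V₂ y i j)
    (hVLp : IntegrableOn (fun y => mnorm (V y) ^ p) (Ycell d))
    (hV₁Lp : IntegrableOn (fun y => mnorm (V₁ y) ^ p) (Ycell d))
    (hV₂Lp : IntegrableOn (fun y => mnorm (V₂ y) ^ p) (Ycell d)) :
    IntegrableOn (fun y => mdot (S y (ξ + V y)) (V₁ y - V₂ y)) (Ycell d) := by
  have hp0 : 0 < p := by linarith
  have hconj : p.HolderConjugate p' := by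
    rw [hp']; exact Real.HolderConjugate.conjExponent hp
  have hmeas : AEMeasurable (fun y => mdot (S y (ξ + V y)) (V₁ y - V₂ y)) := by
    unfold mdot
    refine Finset.aemeasurable_fun_sum _ fun i _ => Finset.aemeasurable_fun_sum _ fun j _ => ?_
    refine AEMeasurable.mul ?_ ((hV₁meas i j).sub (hV₂meas i j)).aemeasurable
    refine carath (fun y ζ => S y ζ i j) (fun ζ => hS2a ζ i j) ?_ (fun y => ξ + V y) ?_
    · filter_upwards [hS2b] with y hy using hy i j
    · refine measurable_pi_lambda _ fun k => measurable_pi_lambda _ fun l => ?_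
      exact measurable_const.add (hVmeas k l)
  have hconst : ∀ c : ℝ, IntegrableOn (fun _ : EuclideanSpace ℝ (Fin d) => c) (Ycell d) :=
    fun c => integrableOn_const (Ycell_lt_top d).ne
  have hb : IntegrableOn (fun y => (2 ^ p * (mnorm (V₁ y) ^ p + mnorm (V₂ y) ^ p)) / p +
      (c₂ * (2 ^ p * (mnorm ξ ^ p + mnorm (V y) ^ p) + 1)) / p') (Ycell d) :=
    (((hV₁Lp.add hV₂Lp).const_mul _).div_const _).add
      ((((((hconst _).add hVLp).const_mul _).add (hconst 1)).const_mul _).div_const _)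
  refine Integrable.mono' hb hmeas.aestronglyMeasurable.restrict (Eventually.of_forall fun y => ?_)
  have h1 : ‖mdot (S y (ξ + V y)) (V₁ y - V₂ y)‖ ≤ mnorm (V₁ y - V₂ y) * mnorm (S y (ξ + V y)) := by
    rw [mdot_eq, mnorm_eq, mnorm_eq, mul_comm]; exact norm_inner_le_norm _ _
  have hn : ∀ A : Matrix (Fin d) (Fin d) ℝ, 0 ≤ mnorm A := fun A => Real.sqrt_nonneg _
  have h2 := Real.young_inequality_of_nonneg (hn (V₁ y - V₂ y)) (hn (S y (ξ + V y))) hconj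
  have h3 : mnorm (V₁ y - V₂ y) ^ p ≤ 2 ^ p * (mnorm (V₁ y) ^ p + mnorm (V₂ y) ^ p) :=
    rpow_add_bd (hn _) (hn _) (hn _) hp0 (by
      rw [mnorm_eq, mnorm_eq, mnorm_eq, mvec_sub]; exact norm_sub_le _ _)
  have h4 : mnorm (ξ + V y) ^ p ≤ 2 ^ p * (mnorm ξ ^ p + mnorm (V y) ^ p) :=
    rpow_add_bd (hn _) (hn _) (hn _) hp0 (by
      rw [mnorm_eq, mnorm_eq, mnorm_eq, mvec_add]; exact norm_add_le _ _)
  have h5 := hS4b y (ξ + V y)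
  have h6 : mnorm (S y (ξ + V y)) ^ p' ≤ c₂ * (2 ^ p * (mnorm ξ ^ p + mnorm (V y) ^ p) + 1) :=
    h5.trans (mul_le_mul_of_nonneg_left (by linarith) hc₂.le)
  have h7 := div_le_div_of_nonneg_right h3 hp0.le
  have h8 := div_le_div_of_nonneg_right h6 hconj.symm.pos.le
  linarith

/-- uniqueness for the cell problem: if `ξ ∈ Sym_d` and
`V₁, V₂ ∈ L^p(Y; Sym_d)` have zero mean and satisfy
`∫_Y S(y, ξ + V_i(y)) : (V₁(y) − V₂(y)) dy = 0` for `i = 1,2`, then `V₁ = V₂`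
almost everywhere in `Y`. -/
theorem stmt10 {d : ℕ} (hd : 1 ≤ d) (p p' c₁ ct₁ c₂ : ℝ)
    (hp : 1 < p) (hp' : p' = p / (p - 1))
    (hc₁ : 0 < c₁) (hct₁ : 0 < ct₁) (hc₂ : 0 < c₂)
    (S : EuclideanSpace ℝ (Fin d) → Matrix (Fin d) (Fin d) ℝ → Matrix (Fin d) (Fin d) ℝ)
    -- (S2) Carathéodory
    (hS2a : ∀ (ξ : Matrix (Fin d) (Fin d) ℝ) (i j : Fin d),
      Measurable fun y => S y ξ i j)
    (hS2b : ∀ᵐ y : EuclideanSpace ℝ (Fin d), ∀ i j : Fin d,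
      Continuous fun ξ => S y ξ i j)
    -- (S3) strict monotonicity
    (hS3 : ∀ᵐ y : EuclideanSpace ℝ (Fin d), ∀ ξ₁ ξ₂ : Matrix (Fin d) (Fin d) ℝ,
      ξ₁ ≠ ξ₂ → 0 < mdot (S y ξ₁ - S y ξ₂) (ξ₁ - ξ₂))
    -- (S4) coercivity and growth
    (hS4a : ∀ (y : EuclideanSpace ℝ (Fin d)) (ξ : Matrix (Fin d) (Fin d) ℝ),
      c₁ * mnorm ξ ^ p - ct₁ ≤ mdot (S y ξ) ξ)
    (hS4b : ∀ (y : EuclideanSpace ℝ (Fin d)) (ξ : Matrix (Fin d) (Fin d) ℝ),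
      mnorm (S y ξ) ^ p' ≤ c₂ * (mnorm ξ ^ p + 1))
    -- the cell-problem data
    (ξ : Matrix (Fin d) (Fin d) ℝ) (hξ : ξᵀ = ξ)
    (V₁ V₂ : EuclideanSpace ℝ (Fin d) → Matrix (Fin d) (Fin d) ℝ)
    (hV₁meas : ∀ i j : Fin d, Measurable fun y => V₁ y i j)
    (hV₂meas : ∀ i j : Fin d, Measurable fun y => V₂ y i j)
    (hV₁sym : ∀ᵐ y ∂(volume.restrict (Ycell d)), (V₁ y)ᵀ = V₁ y)
    (hV₂sym : ∀ᵐ y ∂(volume.restrict (Ycell d)), (V₂ y)ᵀ = V₂ y)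
    (hV₁Lp : IntegrableOn (fun y => mnorm (V₁ y) ^ p) (Ycell d))
    (hV₂Lp : IntegrableOn (fun y => mnorm (V₂ y) ^ p) (Ycell d))
    (hV₁mean : ∀ i j : Fin d, ∫ y in Ycell d, V₁ y i j = 0)
    (hV₂mean : ∀ i j : Fin d, ∫ y in Ycell d, V₂ y i j = 0)
    (hOrth₁ : ∫ y in Ycell d, mdot (S y (ξ + V₁ y)) (V₁ y - V₂ y) = 0)
    (hOrth₂ : ∫ y in Ycell d, mdot (S y (ξ + V₂ y)) (V₁ y - V₂ y) = 0) :
    ∀ᵐ y ∂(volume.restrict (Ycell d)), V₁ y = V₂ y := by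
  have i1 := mdot_integrable p p' c₂ hp hp' hc₂ S hS2a hS2b hS4b ξ V₁ V₁ V₂ hV₁meas hV₁meas hV₂meas
    hV₁Lp hV₁Lp hV₂Lp
  have i2 := mdot_integrable p p' c₂ hp hp' hc₂ S hS2a hS2b hS4b ξ V₂ V₁ V₂ hV₂meas hV₁meas hV₂meas
    hV₂Lp hV₁Lp hV₂Lp
  have h0 := integral_sub i1 i2
  rw [hOrth₁, hOrth₂, sub_zero] at h0
  have hS3' := ae_restrict_of_ae (s := Ycell d) hS3
  have key : ∀ y, mdot (S y (ξ + V₁ y)) (V₁ y - V₂ y) - mdot (S y (ξ + V₂ y)) (V₁ y - V₂ y)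
      = mdot (S y (ξ + V₁ y) - S y (ξ + V₂ y)) ((ξ + V₁ y) - (ξ + V₂ y)) := by
    intro y
    rw [add_sub_add_left_eq_sub, mdot_eq, mdot_eq, mdot_eq, mvec_sub (S y _), inner_sub_left]
  have hz := (integral_eq_zero_iff_of_nonneg_ae (by
    filter_upwards [hS3'] with y hy
    rw [Pi.zero_apply, Pi.sub_apply, key y]
    by_cases h : ξ + V₁ y = ξ + V₂ y
    · rw [h, mdot_eq, mvec_sub, sub_self, inner_zero_left]
    · exact (hy _ _ h).le) (i1.sub i2)).1 h0
  filter_upwards [hS3', hz] with y hy hzy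
  by_contra hne
  have := hy (ξ + V₁ y) (ξ + V₂ y) (fun h => hne (add_left_cancel h))
  rw [← key y] at this
  simp only [Pi.zero_apply, Pi.sub_apply] at hzy
  linarith
end
end

section
/- Chacon's biting lemma: let E ⊂ ℝ^d be a bounded domain and let {vⁿ} be a sequence of functions bounded in L¹(E). Then there exist a subsequence {v^{n_k}}, a function v ∈ L¹(E), and a decreasing sequence of measurable sets E ⊇ E₁ ⊇ E₂ ⊇ … with |E_j| → 0 as j → ∞ such that for each j, v^{n_k} ⇀ v weakly in L¹(E \ E_j) as k → ∞, i.e. ∫_{E \ E_j} v^{n_k} φ → ∫_{E \ E_j} v φ for every φ ∈ L^∞(E \ E_j). -/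
open MeasureTheory Filter Set

noncomputable section

lemma aux_weak {α : Type*} [MeasurableSpace α] (μ : Measure α) [IsFiniteMeasure μ]
    [IsSeparable μ]
    (T : ℕ → ℕ → α → ℝ) (hT : ∀ m n, Measurable (T m n)) (M : ℕ → ℝ)
    (hb : ∀ m n x, |T m n x| ≤ M m) (hM : ∀ m, 0 ≤ M m)
    (a : ℕ → ℕ → ℝ) (C : ℝ) (ha : ∀ m n, a m n ∈ Set.Icc 0 C) :
    ∃ nk : ℕ → ℕ, StrictMono nk ∧ ∃ w : ℕ → α → ℝ,
      (∀ m, Measurable (w m)) ∧ (∀ m, Integrable (w m) μ) ∧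
      ∃ A : ℕ → ℝ, (∀ m, Tendsto (fun k => a m (nk k)) atTop (nhds (A m))) ∧
      ∀ m, ∀ φ : α → ℝ, Measurable φ → (∃ K : ℝ, ∀ x, |φ x| ≤ K) →
        Tendsto (fun k => ∫ x, T m (nk k) x * φ x ∂μ) atTop (nhds (∫ x, w m x * φ x ∂μ)) := by
  have : Fact ((2 : ENNReal) ≠ ⊤) := ⟨by norm_num⟩
  have hmem : ∀ m n, MemLp (T m n) 2 μ := fun m n =>
    MemLp.of_bound (hT m n).aestronglyMeasurable (M m) (Eventually.of_forall (hb m n))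
  let H := Lp ℝ 2 μ
  let R : ℕ → ℝ := fun m => measureUnivNNReal μ ^ (2 : ENNReal).toReal⁻¹ * M m
  let X : ℕ → Set (WeakDual ℝ H) := fun m =>
    WeakDual.toStrongDual ⁻¹' Metric.closedBall (0 : StrongDual ℝ H) (R m)
  have hXc : ∀ m, IsCompact (X m) := fun m => WeakDual.isCompact_closedBall _ _
  have : ∀ m, CompactSpace (X m) := fun m => isCompact_iff_compactSpace.mp (hXc m)
  have : ∀ m, TopologicalSpace.MetrizableSpace (X m) := fun m =>
    WeakDual.metrizable_of_isCompact ℝ H _ (hXc m)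
  let F : ℕ → ℕ → StrongDual ℝ H := fun m n => InnerProductSpace.toDual ℝ H ((hmem m n).toLp _)
  have hF : ∀ m n, StrongDual.toWeakDual (F m n) ∈ X m := by
    intro m n
    show F m n ∈ Metric.closedBall (0 : StrongDual ℝ H) (R m)
    rw [mem_closedBall_zero_iff, LinearIsometryEquiv.norm_map]
    apply Lp.norm_le_of_ae_bound (hM m)
    filter_upwards [(hmem m n).coeFn_toLp] with x hx
    rw [hx]; exact hb m n x
  let Y : ℕ → ((∀ m, X m) × (ℕ → Set.Icc (0:ℝ) C)) := fun n =>
    (fun m => ⟨_, hF m n⟩, fun m => ⟨a m n, ha m n⟩)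
  obtain ⟨⟨p, q⟩, nk, hnk, hlim⟩ := CompactSpace.tendsto_subseq Y
  rw [nhds_prod_eq] at hlim
  have h1 := tendsto_pi_nhds.1 hlim.fst
  have h2 := tendsto_pi_nhds.1 hlim.snd
  let w : ℕ → H := fun m =>
    (InnerProductSpace.toDual ℝ H).symm (WeakDual.toStrongDual (p m : WeakDual ℝ H))
  refine ⟨nk, hnk, fun m => w m, fun m => (Lp.stronglyMeasurable (w m)).measurable,
    fun m => (Lp.memLp (w m)).integrable (by norm_num), fun m => q m, ?_, ?_⟩
  · intro m
    exact (continuous_subtype_val.tendsto _).comp (h2 m)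
  · rintro m φ hφ ⟨K, hK⟩
    have hφm : MemLp φ 2 μ := MemLp.of_bound hφ.aestronglyMeasurable K (Eventually.of_forall hK)
    have h3 : Tendsto (fun k => (StrongDual.toWeakDual (F m (nk k))) (hφm.toLp φ)) atTop
        (nhds ((p m : WeakDual ℝ H) (hφm.toLp φ))) :=
      ((WeakDual.eval_continuous (hφm.toLp φ)).tendsto _).comp
        ((continuous_subtype_val.tendsto _).comp (h1 m))
    have e1 : ∀ k, (StrongDual.toWeakDual (F m (nk k))) (hφm.toLp φ)
        = ∫ x, T m (nk k) x * φ x ∂μ := by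
      intro k
      show inner ℝ ((hmem m (nk k)).toLp _) (hφm.toLp φ) = _
      rw [L2.inner_def]
      apply integral_congr_ae
      filter_upwards [(hmem m (nk k)).coeFn_toLp, hφm.coeFn_toLp] with x hx hy
      rw [hx, hy]; simp [mul_comm]
    have e2 : (p m : WeakDual ℝ H) (hφm.toLp φ) = ∫ x, w m x * φ x ∂μ := by
      have : (p m : WeakDual ℝ H) (hφm.toLp φ) = inner ℝ (w m) (hφm.toLp φ) := by
        rw [InnerProductSpace.toDual_symm_apply]; rfl
      rw [this, L2.inner_def]
      apply integral_congr_ae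
      filter_upwards [hφm.coeFn_toLp] with x hy
      rw [hy]; simp [mul_comm]
    simp_rw [e1, e2] at h3
    exact h3

lemma aux_cauchy {α : Type*} [MeasurableSpace α] (μ : Measure α)
    (w : ℕ → α → ℝ) (hw : ∀ m, Integrable (w m) μ) (A : ℕ → ℝ) (L : ℝ)
    (hA : Tendsto A atTop (nhds L)) (h : ∀ l m, l ≤ m → ∫ x, |w m x - w l x| ∂μ ≤ A m - A l) :
    ∃ v₀ : α → ℝ, Integrable v₀ μ ∧
      Tendsto (fun l => ∫ x, |w l x - v₀ x| ∂μ) atTop (nhds 0) := by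
  let W : ℕ → Lp ℝ 1 μ := fun m => (hw m).toL1 _
  have hd : ∀ l m, l ≤ m → dist (W m) (W l) ≤ A m - A l := by
    intro l m hlm
    refine le_trans (le_of_eq ?_) (h l m hlm)
    rw [dist_eq_norm, ← Integrable.toL1_sub, L1.norm_of_fun_eq_integral_norm]
    simp [Real.norm_eq_abs]
  have hc : CauchySeq W := by
    have hAc := Metric.cauchySeq_iff'.1 hA.cauchySeq
    rw [Metric.cauchySeq_iff']
    intro ε hε
    obtain ⟨N, hN⟩ := hAc ε hε
    refine ⟨N, fun n hn => lt_of_le_of_lt (hd N n hn) ?_⟩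
    have := hN n hn
    rw [Real.dist_eq] at this
    exact lt_of_le_of_lt (le_abs_self _) this
  obtain ⟨V, hV⟩ := cauchySeq_tendsto_of_complete hc
  refine ⟨V, L1.integrable_coeFn V, ?_⟩
  have := tendsto_iff_dist_tendsto_zero.1 hV
  refine this.congr fun l => ?_
  rw [dist_eq_norm, L1.norm_eq_integral_norm]
  apply integral_congr_ae
  filter_upwards [Lp.coeFn_sub (W l) V, (hw l).coeFn_toL1] with x hx hy
  rw [hx, Pi.sub_apply, hy, Real.norm_eq_abs]

lemma aux_hold {α : Type*} [MeasurableSpace α] (μ : Measure α) (f φ : α → ℝ)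
    (hf : Integrable f μ) (K : ℝ) (hK : ∀ x, |φ x| ≤ K) :
    |∫ x, f x * φ x ∂μ| ≤ K * ∫ x, |f x| ∂μ := by
  rw [← integral_const_mul, ← Real.norm_eq_abs]
  apply norm_integral_le_of_norm_le (hf.abs.const_mul K)
  refine Eventually.of_forall fun x => ?_
  rw [Real.norm_eq_abs, abs_mul, mul_comm]
  exact mul_le_mul_of_nonneg_right (hK x) (abs_nonneg _)

lemma aux_int_s14 {α : Type*} [MeasurableSpace α] (μ : Measure α) (f φ : α → ℝ)
    (hf : Integrable f μ) (hφ : Measurable φ) (K : ℝ) (hK : ∀ x, |φ x| ≤ K) :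
    Integrable (fun x => f x * φ x) μ :=
  hf.mul_bdd (c := K) hφ.aestronglyMeasurable (Eventually.of_forall hK)

lemma aux_bite {α : Type*} [MeasurableSpace α] (μ : Measure α) [IsFiniteMeasure μ]
    [IsSeparable μ] (v : ℕ → α → ℝ) (hv : ∀ n, Measurable (v n))
    (hi : ∀ n, Integrable (v n) μ) (C : ℝ) (hC : ∀ n, ∫ x, |v n x| ∂μ ≤ C) :
    ∃ nk : ℕ → ℕ, StrictMono nk ∧ ∃ v₀ : α → ℝ, Integrable v₀ μ ∧
      ∃ B : ℕ → Set α, (∀ j, MeasurableSet (B j)) ∧ Antitone B ∧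
        Tendsto (fun j => μ (B j)) atTop (nhds 0) ∧
        ∀ j, ∀ φ : α → ℝ, Measurable φ → (∃ K : ℝ, ∀ x, |φ x| ≤ K) →
        Tendsto (fun k => ∫ x in (B j)ᶜ, v (nk k) x * φ x ∂μ) atTop
          (nhds (∫ x in (B j)ᶜ, v₀ x * φ x ∂μ)) := by
  classical
  let T : ℕ → ℕ → α → ℝ := fun m n x => if |v n x| ≤ 2 ^ m then v n x else 0
  have hT : ∀ m n, Measurable (T m n) := fun m n =>
    Measurable.ite (measurableSet_le (hv n).abs measurable_const) (hv n) measurable_const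
  have hTb : ∀ m n x, |T m n x| ≤ 2 ^ m := by
    intro m n x
    simp only [T]
    split_ifs with h
    · exact h
    · simp
  have hTv : ∀ m n x, |T m n x| ≤ |v n x| := by
    intro m n x
    simp only [T]
    split_ifs with h
    · exact le_rfl
    · simp
  have hTi : ∀ m n, Integrable (T m n) μ := fun m n =>
    (hi n).mono (hT m n).aestronglyMeasurable (Eventually.of_forall (hTv m n))
  have hTd : ∀ l m, l ≤ m → ∀ n x, |T m n x - T l n x| = |T m n x| - |T l n x| := by
    intro l m hlm n x
    have h2 : (2:ℝ) ^ l ≤ 2 ^ m := pow_le_pow_right₀ (by norm_num) hlm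
    simp only [T]
    by_cases h : |v n x| ≤ 2 ^ l
    · rw [if_pos h, if_pos (h.trans h2)]; simp
    · rw [if_neg h]; simp
  let a : ℕ → ℕ → ℝ := fun m n => ∫ x, |T m n x| ∂μ
  have ha : ∀ m n, a m n ∈ Set.Icc 0 C := fun m n =>
    ⟨integral_nonneg fun x => abs_nonneg _,
      (integral_mono (hTi m n).abs (hi n).abs (hTv m n)).trans (hC n)⟩
  have had : ∀ l m, l ≤ m → ∀ n, ∫ x, |T m n x - T l n x| ∂μ = a m n - a l n := by
    intro l m hlm n
    simp_rw [hTd l m hlm n]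
    exact integral_sub (hTi m n).abs (hTi l n).abs
  obtain ⟨n1, hn1, w, hwm, hwi, A, hA, hw⟩ :=
    aux_weak μ T hT (fun m => 2 ^ m) hTb (fun m => by positivity) a C ha
  have hwd : ∀ l m, l ≤ m → ∫ x, |w m x - w l x| ∂μ ≤ A m - A l := by
    intro l m hlm
    let φ : α → ℝ := fun x => if w l x ≤ w m x then 1 else -1
    have hφ : Measurable φ :=
      Measurable.ite (measurableSet_le (hwm l) (hwm m)) measurable_const measurable_const
    have hφ1 : ∀ x, |φ x| ≤ 1 := by
      intro x; simp only [φ]; split_ifs <;> simp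
    have e : ∫ x, |w m x - w l x| ∂μ = ∫ x, w m x * φ x ∂μ - ∫ x, w l x * φ x ∂μ := by
      rw [← integral_sub (aux_int_s14 μ _ _ (hwi m) hφ 1 hφ1) (aux_int_s14 μ _ _ (hwi l) hφ 1 hφ1)]
      congr 1; ext x
      simp only [φ]
      split_ifs with h
      · rw [abs_of_nonneg (by linarith)]; ring
      · rw [abs_of_nonpos (by linarith)]; ring
    rw [e]
    refine le_of_tendsto_of_tendsto' ((hw m φ hφ ⟨1, hφ1⟩).sub (hw l φ hφ ⟨1, hφ1⟩))
      ((hA m).sub (hA l)) fun k => ?_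
    rw [← integral_sub (aux_int_s14 μ _ _ (hTi m _) hφ 1 hφ1) (aux_int_s14 μ _ _ (hTi l _) hφ 1 hφ1),
      ← had l m hlm]
    have := aux_hold μ (fun x => T m (n1 k) x - T l (n1 k) x) φ ((hTi m _).sub (hTi l _)) 1 hφ1
    rw [one_mul] at this
    simp_rw [sub_mul] at this
    exact (le_abs_self _).trans this
  have hAmono : Monotone A := by
    intro l m hlm
    have := (integral_nonneg fun x => abs_nonneg (w m x - w l x)).trans (hwd l m hlm)
    linarith
  have hAC : ∀ m, A m ≤ C := fun m => le_of_tendsto' (hA m) fun k => (ha m _).2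
  obtain ⟨L, hL⟩ : ∃ L, Tendsto A atTop (nhds L) :=
    ⟨_, tendsto_atTop_ciSup hAmono ⟨C, by rintro _ ⟨m, rfl⟩; exact hAC m⟩⟩
  obtain ⟨v₀, hv₀, hwv⟩ := aux_cauchy μ w hwi A L hL hwd
  obtain ⟨σ, hσ, hσ2⟩ := extraction_forall_of_eventually
    (P := fun k i => |a k (n1 i) - A k| < 1 / ((k:ℝ) + 1)) (fun k => by
      have := Metric.tendsto_nhds.1 (hA k) (1 / ((k:ℝ) + 1)) (by positivity)
      simpa [Real.dist_eq] using this)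
  let nk := fun k => n1 (σ k)
  have hD : Tendsto (fun k => a k (nk k)) atTop (nhds L) := by
    have h0 : Tendsto (fun k => a k (nk k) - A k) atTop (nhds 0) :=
      squeeze_zero_norm (fun k => (hσ2 k).le) tendsto_one_div_add_atTop_nhds_zero_nat
    simpa using h0.add hL
  have key : ∀ φ : α → ℝ, Measurable φ → (∃ K : ℝ, ∀ x, |φ x| ≤ K) →
      Tendsto (fun k => ∫ x, T k (nk k) x * φ x ∂μ) atTop (nhds (∫ x, v₀ x * φ x ∂μ)) := by
    rintro φ hφ ⟨K, hK⟩
    rw [Metric.tendsto_nhds]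
    intro ε hε
    have r0 : Tendsto (fun l => K * (L - A l) + K * ∫ x, |w l x - v₀ x| ∂μ) atTop (nhds 0) := by
      have := ((hL.const_sub L).const_mul K).add (hwv.const_mul K)
      simpa using this
    obtain ⟨l, hl⟩ := (r0.eventually (gt_mem_nhds hε)).exists
    have hwl := (hw l φ hφ ⟨K, hK⟩).comp hσ.tendsto_atTop
    have t1 : Tendsto (fun k => K * (a k (nk k) - a l (nk k))
        + |∫ x, T l (nk k) x * φ x ∂μ - ∫ x, w l x * φ x ∂μ|
        + K * ∫ x, |w l x - v₀ x| ∂μ) atTop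
        (nhds (K * (L - A l) + 0 + K * ∫ x, |w l x - v₀ x| ∂μ)) := by
      refine Tendsto.add_const _ (Tendsto.add ?_ ?_)
      · exact (hD.sub ((hA l).comp hσ.tendsto_atTop)).const_mul K
      · have := (hwl.sub_const (∫ x, w l x * φ x ∂μ)).abs
        simpa using this
    rw [add_zero] at t1
    filter_upwards [t1.eventually (gt_mem_nhds hl), eventually_ge_atTop l] with k hk hlk
    refine lt_of_le_of_lt ?_ hk
    rw [Real.dist_eq]
    have i1 := aux_hold μ (fun x => T k (nk k) x - T l (nk k) x) φ ((hTi k _).sub (hTi l _)) K hK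
    rw [had l k hlk] at i1
    have i2 := aux_hold μ (fun x => w l x - v₀ x) φ ((hwi l).sub hv₀) K hK
    simp_rw [sub_mul] at i1 i2
    rw [integral_sub (aux_int_s14 μ _ _ (hTi k _) hφ K hK) (aux_int_s14 μ _ _ (hTi l _) hφ K hK)] at i1
    rw [integral_sub (aux_int_s14 μ _ _ (hwi l) hφ K hK) (aux_int_s14 μ _ _ hv₀ hφ K hK)] at i2
    refine le_trans ?_ (add_le_add (add_le_add i1 le_rfl) i2)
    refine le_trans (le_of_eq ?_) (abs_add_three _ _ _)
    congr 1; ring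
  let S : ℕ → Set α := fun k => {x | 2 ^ k < |v (nk k) x|}
  have hS : ∀ k, MeasurableSet (S k) := fun k => measurableSet_lt measurable_const (hv _).abs
  have hSm : ∀ k, μ (S k) ≤ ENNReal.ofReal (C * (1 / 2) ^ k) := by
    intro k
    have h1 := mul_meas_ge_le_integral_of_nonneg (μ := μ) (f := fun x => |v (nk k) x|)
      (Eventually.of_forall fun x => abs_nonneg _) (hi _).abs (2 ^ k)
    have h2 : μ.real (S k) ≤ μ.real {x | 2 ^ k ≤ |v (nk k) x|} :=
      measureReal_mono (fun x (hx : 2 ^ k < |v (nk k) x|) => show 2 ^ k ≤ |v (nk k) x| from hx.le)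
    have h3 : μ.real (S k) ≤ C * (1 / 2) ^ k := by
      have hp : (0:ℝ) < 2 ^ k := by positivity
      rw [one_div, inv_pow, ← div_eq_mul_inv, le_div_iff₀ hp, mul_comm]
      exact (mul_le_mul_of_nonneg_left h2 hp.le).trans (h1.trans (hC _))
    rw [← ofReal_measureReal (measure_ne_top μ _)]
    exact ENNReal.ofReal_le_ofReal h3
  have hSs : ∑' k, μ (S k) ≠ ⊤ := by
    have hs : Summable fun k : ℕ => C * (1 / 2 : ℝ) ^ k :=
      (summable_geometric_of_lt_one (by norm_num) (by norm_num)).mul_left C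
    exact ne_top_of_le_ne_top hs.tsum_ofReal_ne_top (ENNReal.tsum_le_tsum hSm)
  let B : ℕ → Set α := fun j => ⋃ k, S (k + j)
  have hB : ∀ j, MeasurableSet (B j) := fun j => MeasurableSet.iUnion fun k => hS _
  refine ⟨nk, hn1.comp hσ, v₀, hv₀, B, hB, ?_, ?_, ?_⟩
  · intro i j hij x hx
    obtain ⟨k, hk⟩ := mem_iUnion.1 hx
    refine mem_iUnion.2 ⟨k + (j - i), ?_⟩
    rwa [show k + (j - i) + i = k + j by omega]
  · exact tendsto_of_tendsto_of_tendsto_of_le_of_le tendsto_const_nhds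
      (ENNReal.tendsto_sum_nat_add _ hSs) (fun j => zero_le) (fun j => measure_iUnion_le _)
  · rintro j φ hφ ⟨K, hK⟩
    have h1 := key ((B j)ᶜ.indicator φ) (hφ.indicator (hB j).compl) ⟨K, fun x => by
      by_cases hx : x ∈ (B j)ᶜ
      · rw [indicator_of_mem hx]; exact hK x
      · rw [indicator_of_notMem hx, abs_zero]; exact (abs_nonneg _).trans (hK x)⟩
    have e : ∀ f : α → ℝ, ∫ x, f x * (B j)ᶜ.indicator φ x ∂μ = ∫ x in (B j)ᶜ, f x * φ x ∂μ := by
      intro f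
      rw [← integral_indicator (hB j).compl]
      congr 1; ext x
      by_cases hx : x ∈ (B j)ᶜ
      · rw [indicator_of_mem hx, indicator_of_mem hx]
      · rw [indicator_of_notMem hx, indicator_of_notMem hx, mul_zero]
    simp_rw [e] at h1
    refine h1.congr' ?_
    filter_upwards [eventually_ge_atTop j] with k hk
    refine setIntegral_congr_fun (hB j).compl fun x hx => ?_
    have : x ∉ S k := fun h => hx (mem_iUnion.2 ⟨k - j, by rwa [Nat.sub_add_cancel hk]⟩)
    have h' : |v (nk k) x| ≤ 2 ^ k := not_lt.1 this
    simp only [T, if_pos h']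

/-- Chacon's biting lemma: let `E ⊂ ℝ^d` be a bounded domain and
`{vⁿ}` a sequence bounded in `L¹(E)`.  Then there are a subsequence `{v^{n_k}}`,
a function `v ∈ L¹(E)` and a decreasing sequence of measurable sets
`E ⊇ E₁ ⊇ E₂ ⊇ …` with `|E_j| → 0` such that for each `j`,
`v^{n_k} ⇀ v` weakly in `L¹(E \ E_j)`, i.e. `∫_{E \ E_j} v^{n_k} φ → ∫_{E \ E_j} v φ`
for every `φ ∈ L^∞(E \ E_j)`. -/
theorem stmt14 {d : ℕ} (hd : 1 ≤ d)
    (E : Set (EuclideanSpace ℝ (Fin d))) (hEo : IsOpen E)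
    (hEb : Bornology.IsBounded E)
    (v : ℕ → EuclideanSpace ℝ (Fin d) → ℝ)
    (hint : ∀ n, IntegrableOn (v n) E)
    (hbdd : ∃ C : ℝ, ∀ n, ∫ x in E, |v n x| ≤ C) :
    ∃ nk : ℕ → ℕ, StrictMono nk ∧
    ∃ v₀ : EuclideanSpace ℝ (Fin d) → ℝ, IntegrableOn v₀ E ∧
    ∃ Es : ℕ → Set (EuclideanSpace ℝ (Fin d)),
      (∀ j, Es j ⊆ E) ∧
      (∀ j, MeasurableSet (Es j)) ∧
      Antitone Es ∧
      Tendsto (fun j => volume (Es j)) atTop (nhds 0) ∧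
      ∀ j, ∀ φ : EuclideanSpace ℝ (Fin d) → ℝ, Measurable φ →
        (∃ C : ℝ, ∀ x, |φ x| ≤ C) →
        Tendsto (fun k => ∫ x in E \ Es j, v (nk k) x * φ x) atTop
          (nhds (∫ x in E \ Es j, v₀ x * φ x)) := by
  obtain ⟨C, hC⟩ := hbdd
  have hfin : volume E < ⊤ := hEb.measure_lt_top
  haveI : IsFiniteMeasure (volume.restrict E) := ⟨by simpa using hfin⟩
  have hE := hEo.measurableSet
  have hae : ∀ n, AEMeasurable (v n) (volume.restrict E) := fun n => (hint n).1.aemeasurable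
  let u : ℕ → EuclideanSpace ℝ (Fin d) → ℝ := fun n => (hae n).mk
  have hu : ∀ n, v n =ᵐ[volume.restrict E] u n := fun n => (hae n).ae_eq_mk
  obtain ⟨nk, hnk, v₀, hv₀, B, hB, hBa, hB0, hlim⟩ := aux_bite (volume.restrict E) u
    (fun n => (hae n).measurable_mk) (fun n => (hint n).congr (hu n)) C (fun n => by
      refine le_trans (le_of_eq ?_) (hC n)
      apply integral_congr_ae
      filter_upwards [hu n] with x hx
      rw [hx])
  have hr : ∀ j, (volume.restrict E).restrict (B j)ᶜ = volume.restrict (E \ (E ∩ B j)) := by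
    intro j
    rw [Measure.restrict_restrict (hB j).compl, diff_self_inter, diff_eq, inter_comm]
  refine ⟨nk, hnk, v₀, hv₀, fun j => E ∩ B j, fun j => inter_subset_left,
    fun j => hE.inter (hB j), fun i j hij => inter_subset_inter_right _ (hBa hij), ?_, ?_⟩
  · refine hB0.congr fun j => ?_
    rw [Measure.restrict_apply (hB j), inter_comm]
  · intro j φ hφ hK
    have h := hlim j φ hφ hK
    rw [hr j] at h
    refine h.congr fun k => ?_
    apply integral_congr_ae
    have := ae_restrict_of_ae_restrict_of_subset (diff_subset : E \ (E ∩ B j) ⊆ E) (hu (nk k))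
    filter_upwards [this] with x hx
    rw [hx]
end
end

section
/- Let Ω ⊂ ℝ^d be a bounded measurable set and let {G^k} be a sequence of functions bounded in L¹(Ω). Then there exist a subsequence (not relabeled) and measurable sets Ω₁ ⊆ Ω₂ ⊆ … ⊆ Ω with |Ω \ Ω_n| → 0 as n → ∞ such that for every n ∈ ℕ and every θ > 0 there is δ > 0 with the property: for every k ∈ ℕ and every measurable K ⊆ Ω_n with |K| < δ one has ∫_K |G^k| < θ (the subsequence is uniformly integrable on each Ω_n). -/
open MeasureTheory Filter Set

noncomputable section

theorem aux_abs {α : Type*} [MeasurableSpace α] (μ : Measure α)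
    (f : α → ℝ) (h0 : ∀ x, 0 ≤ f x) (hi : Integrable f μ) (θ : ℝ) (hθ : 0 < θ) :
    ∃ δ : ℝ, 0 < δ ∧ ∀ K : Set α, μ K < ENNReal.ofReal δ → ∫ x in K, f x ∂μ < θ := by
  have h1 : ∫⁻ x, ENNReal.ofReal (f x) ∂μ ≠ ⊤ := by
    rw [← ofReal_integral_eq_lintegral_ofReal hi (ae_of_all _ h0)]
    exact ENNReal.ofReal_ne_top
  obtain ⟨δ, hδ, h⟩ := exists_pos_setLIntegral_lt_of_measure_lt h1
    (ε := ENNReal.ofReal θ) (by simpa using hθ)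
  have hm : min δ 1 ≠ ⊤ := by simp
  refine ⟨(min δ 1).toReal, ENNReal.toReal_pos (by simp [hδ.ne']) hm, fun K hK => ?_⟩
  rw [ENNReal.ofReal_toReal hm] at hK
  have := h K (hK.trans_le (min_le_left _ _))
  rw [← ofReal_integral_eq_lintegral_ofReal hi.restrict (ae_of_all _ h0)] at this
  exact (ENNReal.ofReal_lt_ofReal_iff hθ).1 this

theorem aux_fin {α : Type*} [MeasurableSpace α] (μ : Measure α)
    (f : ℕ → α → ℝ) (h0 : ∀ k x, 0 ≤ f k x) (hi : ∀ k, Integrable (f k) μ) (θ : ℝ) (hθ : 0 < θ)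
    (J : ℕ) :
    ∃ δ : ℝ, 0 < δ ∧ ∀ j < J, ∀ K : Set α, μ K < ENNReal.ofReal δ → ∫ x in K, f j x ∂μ < θ := by
  induction J with
  | zero => exact ⟨1, one_pos, by simp⟩
  | succ J ih =>
    obtain ⟨δ, hδ, h⟩ := ih
    obtain ⟨δ', hδ', h'⟩ := aux_abs μ (f J) (h0 J) (hi J) θ hθ
    refine ⟨min δ δ', lt_min hδ hδ', fun j hj K hK => ?_⟩
    rcases Nat.lt_succ_iff_lt_or_eq.1 hj with hj | rfl
    · exact h j hj K (hK.trans_le (ENNReal.ofReal_le_ofReal (min_le_left _ _)))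
    · exact h' K (hK.trans_le (ENNReal.ofReal_le_ofReal (min_le_right _ _)))

theorem aux_main {α : Type*} [MeasurableSpace α] (μ : Measure α) [IsFiniteMeasure μ]
    (f : ℕ → α → ℝ) (h0 : ∀ k x, 0 ≤ f k x) (hm : ∀ k, Measurable (f k))
    (hi : ∀ k, Integrable (f k) μ) (C : ℝ) (hC : ∀ k, ∫ x, f k x ∂μ ≤ C) :
    ∃ nk : ℕ → ℕ, StrictMono nk ∧ ∃ E : ℕ → Set α, (∀ n, MeasurableSet (E n)) ∧ Monotone E ∧
      Tendsto (fun n => μ (E n)ᶜ) atTop (nhds 0) ∧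
      ∀ n : ℕ, ∀ θ : ℝ, 0 < θ → ∃ δ : ℝ, 0 < δ ∧ ∀ k : ℕ, ∀ K : Set α, K ⊆ E n →
        MeasurableSet K → μ K < ENNReal.ofReal δ → ∫ x in K, f (nk k) x ∂μ < θ := by
  have hti : ∀ k m, Integrable (fun x => min (f k x) ((2:ℝ)^m)) μ := fun k m =>
    (hi k).inf (integrable_const ((2:ℝ)^m))
  let a : ℕ → ℕ → ℝ := fun k m => ∫ x, min (f k x) ((2:ℝ)^m) ∂μ
  have ha0 : ∀ k m, 0 ≤ a k m := fun k m =>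
    integral_nonneg fun x => le_min (h0 k x) (by positivity)
  have haC : ∀ k m, a k m ≤ C := fun k m =>
    (integral_mono (hti k m) (hi k) fun x => min_le_left _ _).trans (hC k)
  have hamono : ∀ k, Monotone (a k) := fun k m m' h =>
    integral_mono (hti k m) (hti k m') fun x =>
      min_le_min le_rfl (pow_le_pow_right₀ (by norm_num) h)
  have hcpt : IsCompact (Set.pi univ fun _ : ℕ => Icc (0:ℝ) C) :=
    isCompact_univ_pi fun _ => isCompact_Icc
  obtain ⟨A, hA, φ, hφ, hlim⟩ := hcpt.tendsto_subseq (x := a)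
    (fun k m _ => ⟨ha0 k m, haC k m⟩)
  have hlim' : ∀ m, Tendsto (fun j => a (φ j) m) atTop (nhds (A m)) := fun m =>
    (tendsto_pi_nhds.1 hlim) m
  have hAmono : Monotone A := fun m m' h =>
    le_of_tendsto_of_tendsto' (hlim' m) (hlim' m') fun j => hamono _ h
  have hAb : BddAbove (range A) := ⟨C, by rintro _ ⟨m, rfl⟩; exact (hA m (mem_univ _)).2⟩
  have hAlim := tendsto_atTop_ciSup hAmono hAb
  set L := ⨆ m, A m
  have hAL : ∀ m, A m ≤ L := fun m => le_ciSup hAb m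
  obtain ⟨ψ, hψ, hψ'⟩ := extraction_forall_of_eventually
    (P := fun j k => a (φ k) j < A j + 1 / ((j:ℝ) + 1)) (fun j =>
      (hlim' j).eventually_lt_const (by
        have : (0:ℝ) < 1 / ((j:ℝ)+1) := by positivity
        linarith))
  let nk := fun j => φ (ψ j)
  let B : ℕ → Set α := fun j => {x | (2:ℝ)^j ≤ f (nk j) x}
  have hBm : ∀ j, MeasurableSet (B j) := fun j => measurableSet_le measurable_const (hm _)
  have hBμ : ∀ j, μ (B j) ≤ ENNReal.ofReal (C * (1/2)^j) := by
    intro j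
    have := mul_meas_ge_le_integral_of_nonneg (ae_of_all _ (h0 (nk j))) (hi (nk j)) ((2:ℝ)^j)
    rw [← ofReal_measureReal]
    apply ENNReal.ofReal_le_ofReal
    have h2 : (2:ℝ)^j * μ.real (B j) ≤ C := this.trans (hC _)
    rw [one_div, inv_pow, ← div_eq_mul_inv, le_div_iff₀ (by positivity)]
    linarith
  have hsum : ∑' j, μ (B j) ≠ ⊤ := by
    have hs : Summable (fun j : ℕ => C * (1/2:ℝ)^j) :=
      (summable_geometric_of_lt_one (by norm_num) (by norm_num)).mul_left C
    exact ne_top_of_le_ne_top hs.tsum_ofReal_ne_top (ENNReal.tsum_le_tsum hBμ)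
  refine ⟨nk, hφ.comp hψ, fun n => (⋃ j, B (j + n))ᶜ, fun n =>
    (MeasurableSet.iUnion fun j => hBm _).compl, ?_, ?_, ?_⟩
  · intro n n' h
    apply compl_subset_compl.2
    apply iUnion_subset
    intro j
    have : j + n' = (j + (n' - n)) + n := by omega
    rw [this]
    exact subset_iUnion (fun j => B (j + n)) _
  · simp only [compl_compl]
    refine tendsto_of_tendsto_of_tendsto_of_le_of_le tendsto_const_nhds
      (ENNReal.tendsto_sum_nat_add _ hsum) (fun _ => bot_le) (fun n => measure_iUnion_le _)
  · intro n θ hθ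
    obtain ⟨m, hmL⟩ := (hAlim.eventually_const_lt (show L - θ/4 < L by linarith)).exists
    have e1 : ∀ᶠ j in atTop, A m - θ/8 < a (nk j) m :=
      ((hlim' m).comp hψ.tendsto_atTop).eventually_const_lt (by linarith)
    have e2 : ∀ᶠ j : ℕ in atTop, 1 / ((j:ℝ)+1) < θ/8 :=
      tendsto_one_div_add_atTop_nhds_zero_nat.eventually_lt_const (by linarith)
    obtain ⟨J, hJ⟩ := eventually_atTop.1 (e1.and (e2.and ((eventually_ge_atTop n).and
      (eventually_ge_atTop m))))
    obtain ⟨δ, hδ, hfin⟩ := aux_fin μ (fun j => f (nk j)) (fun j => h0 _) (fun j => hi _) θ hθ J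
    refine ⟨min δ (θ/4/2^m), lt_min hδ (by positivity), fun k K hK hKm hμK => ?_⟩
    rcases lt_or_ge k J with hk | hk
    · exact hfin k hk K (hμK.trans_le (ENNReal.ofReal_le_ofReal (min_le_left _ _)))
    obtain ⟨h1, h2, h3, h4⟩ := hJ k hk
    have hKr : μ.real K < θ/4/2^m := by
      have := hμK.trans_le (ENNReal.ofReal_le_ofReal (min_le_right _ _))
      rw [← ofReal_measureReal] at this
      exact (ENNReal.ofReal_lt_ofReal_iff (by positivity)).1 this
    have hKr' : μ.real K * 2^m < θ/4 := (lt_div_iff₀ (by positivity)).1 hKr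
    have hle : ∀ x ∈ K, f (nk k) x ≤ (2:ℝ)^k := by
      intro x hx
      have := hK hx
      simp only [mem_compl_iff, mem_iUnion, not_exists] at this
      have := this (k - n)
      rw [Nat.sub_add_cancel h3] at this
      exact (not_le.1 this).le
    have i1 : ∫ x in K, f (nk k) x ∂μ = ∫ x in K, min (f (nk k) x) (2^m) ∂μ +
        ∫ x in K, (min (f (nk k) x) (2^k) - min (f (nk k) x) (2^m)) ∂μ := by
      rw [integral_sub (hti _ _).restrict (hti _ _).restrict, add_sub_cancel]
      refine setIntegral_congr_fun hKm fun x hx => ?_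
      exact (min_eq_left (hle x hx)).symm
    have i2 : ∫ x in K, min (f (nk k) x) (2^m) ∂μ ≤ μ.real K * 2^m := by
      have : ∫ x in K, min (f (nk k) x) (2^m) ∂μ ≤ ∫ x in K, (2:ℝ)^m ∂μ :=
        integral_mono (hti _ _).restrict (integrable_const _) fun x => min_le_right _ _
      simpa using this
    have i3 : ∫ x in K, (min (f (nk k) x) (2^k) - min (f (nk k) x) (2^m)) ∂μ
        ≤ a (nk k) k - a (nk k) m := by
      rw [← integral_sub (hti _ _) (hti _ _)]
      refine setIntegral_le_integral ((hti _ _).sub (hti _ _)) (ae_of_all _ fun x => ?_)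
      exact sub_nonneg.2 (min_le_min le_rfl (pow_le_pow_right₀ (by norm_num) h4))
    have := hψ' k
    have := hAL k
    have : a (nk k) k < A k + 1 / ((k:ℝ)+1) := hψ' k
    linarith

/-- equiintegrability on an exhausting family of sets: let
`Ω ⊂ ℝ^d` be bounded measurable and `{G^k}` bounded in `L¹(Ω)`.  Then there are a
subsequence and measurable sets `Ω₁ ⊆ Ω₂ ⊆ … ⊆ Ω` with `|Ω \ Ω_n| → 0` such that
for every `n` and `θ > 0` there is `δ > 0` with: for every `k` and every measurable
`K ⊆ Ω_n` with `|K| < δ` one has `∫_K |G^k| < θ`. -/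
theorem stmt16 {d : ℕ} (hd : 1 ≤ d)
    (Ω : Set (EuclideanSpace ℝ (Fin d))) (hΩm : MeasurableSet Ω)
    (hΩb : Bornology.IsBounded Ω)
    (G : ℕ → EuclideanSpace ℝ (Fin d) → ℝ)
    (hint : ∀ k, IntegrableOn (G k) Ω)
    (hbdd : ∃ C : ℝ, ∀ k, ∫ x in Ω, |G k x| ≤ C) :
    ∃ nk : ℕ → ℕ, StrictMono nk ∧
    ∃ Ωn : ℕ → Set (EuclideanSpace ℝ (Fin d)),
      (∀ n, Ωn n ⊆ Ω) ∧
      (∀ n, MeasurableSet (Ωn n)) ∧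
      Monotone Ωn ∧
      Tendsto (fun n => volume (Ω \ Ωn n)) atTop (nhds 0) ∧
      ∀ n : ℕ, ∀ θ : ℝ, 0 < θ → ∃ δ : ℝ, 0 < δ ∧
        ∀ k : ℕ, ∀ K : Set (EuclideanSpace ℝ (Fin d)), K ⊆ Ωn n → MeasurableSet K →
          volume K < ENNReal.ofReal δ → ∫ x in K, |G (nk k) x| < θ := by
  obtain ⟨C, hC⟩ := hbdd
  haveI : IsFiniteMeasure (volume.restrict Ω) := ⟨by
    simpa using hΩb.measure_lt_top⟩
  have hae : ∀ k, (fun x => |(hint k).aestronglyMeasurable.mk (G k) x|)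
      =ᵐ[volume.restrict Ω] fun x => |G k x| := fun k => by
    filter_upwards [(hint k).aestronglyMeasurable.ae_eq_mk] with x hx
    rw [hx]
  obtain ⟨nk, hnk, E, hEm, hE, hlim, h⟩ := aux_main (volume.restrict Ω)
    (fun k x => |(hint k).aestronglyMeasurable.mk (G k) x|) (fun k x => abs_nonneg _)
    (fun k => (hint k).aestronglyMeasurable.stronglyMeasurable_mk.measurable.abs)
    (fun k => (hint k).abs.congr (hae k).symm) C
    (fun k => (integral_congr_ae (hae k)).trans_le (hC k))
  refine ⟨nk, hnk, fun n => Ω ∩ E n, fun n => inter_subset_left, fun n => hΩm.inter (hEm n),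
    fun n n' hn => inter_subset_inter_right _ (hE hn), ?_, ?_⟩
  · refine hlim.congr fun n => ?_
    rw [Measure.restrict_apply (hEm n).compl, diff_self_inter, diff_eq, inter_comm]
  · intro n θ hθ
    obtain ⟨δ, hδ, h⟩ := h n θ hθ
    refine ⟨δ, hδ, fun k K hK hKm hμ => ?_⟩
    have hKΩ : K ⊆ Ω := hK.trans inter_subset_left
    have := h k K (hK.trans inter_subset_right) hKm (by
      rwa [Measure.restrict_apply hKm, inter_eq_left.2 hKΩ])
    rw [integral_congr_ae (ae_restrict_of_ae (hae (nk k))),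
      Measure.restrict_restrict hKm, inter_eq_left.2 hKΩ] at this
    exact this
end
end
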